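/- Assume Ω is nonempty and there exists x₁ ∈ [0, A] with x₁² < P and ℰ(x₁) > E_req. Then the capacity-achieving input distribution F* (the unique maximizer of I over Ω) has a mass point at zero: 0 belongs to the topological support of F*. -/

import Mathlib

open MeasureTheory Real Set Filter

/-- Phase-removed Rayleigh-fading channel density `p(y|x)`. -/
noncomputable def pcond (x y : ℝ) : ℝ := (1 / (1 + x ^ 2)) * Real.exp (-y / (1 + x ^ 2))

/-- Modified Bessel function of the first kind, order zero. -/
noncomputable def besselI0 (t : ℝ) : ℝ := ∑' n : ℕ, (t ^ 2 / 4) ^ n / ((Nat.factorial n : ℝ)) ^ 2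

/-- Harvested-energy function `ℰ(x) = I₀(√2 B h₂ x)`. -/
noncomputable def EH (B h2 x : ℝ) : ℝ := besselI0 (Real.sqrt 2 * B * h2 * x)

/-- Output density `p(y; F)`. -/
noncomputable def pout (F : Measure ℝ) (y : ℝ) : ℝ := ∫ x, pcond x y ∂F

/-- Mutual-information density `i(x; F)`. -/
noncomputable def idens (F : Measure ℝ) (x : ℝ) : ℝ :=
  ∫ y in Set.Ioi (0 : ℝ), pcond x y * Real.log (pcond x y / pout F y)

/-- Mutual information `I(F)`. -/
noncomputable def MI (F : Measure ℝ) : ℝ := ∫ x, idens F x ∂F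

/-- Borel probability measure concentrated on `[0, A]`. -/
def IsDistOn (A : ℝ) (F : Measure ℝ) : Prop :=
  IsProbabilityMeasure F ∧ F (Set.Icc 0 A)ᶜ = 0

/-- The feasible set `Ω`: probability measures on `[0,A]` meeting the AP and EH constraints. -/
def Feas (A P B h2 Ereq : ℝ) (F : Measure ℝ) : Prop :=
  IsDistOn A F ∧ (∫ x, x ^ 2 ∂F) ≤ P ∧ Ereq ≤ ∫ x, EH B h2 x ∂F

/-- Information-energy capacity `C = sup_{F ∈ Ω} I(F)`. -/
noncomputable def Cap (A P B h2 Ereq : ℝ) : ℝ :=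
  sSup (MI '' {F | Feas A P B h2 Ereq F})

/-- Topological support of a measure: points all of whose open neighborhoods have
positive measure (the smallest closed set of full measure). -/
def msupp {X : Type*} [TopologicalSpace X] [MeasurableSpace X] (μ : Measure X) : Set X :=
  {x | ∀ U : Set X, IsOpen U → x ∈ U → 0 < μ U}

lemma pcond_pos (x y : ℝ) : 0 < pcond x y := by
  unfold pcond; positivity

lemma continuous_uncurry_pcond : Continuous (Function.uncurry pcond) := by
  unfold Function.uncurry pcond
  have h : ∀ p : ℝ × ℝ, 1 + p.1 ^ 2 ≠ 0 := fun p => by positivity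
  fun_prop (disch := simpa using h)

lemma continuous_pcond_left (y : ℝ) : Continuous fun x => pcond x y :=
  continuous_uncurry_pcond.comp (Continuous.prodMk_left y)

lemma le_pcond {A x y : ℝ} (hx : x ∈ Icc 0 A) (hy : 0 ≤ y) :
    (1 + A ^ 2)⁻¹ * Real.exp (-y) ≤ pcond x y := by
  have hxA : x ^ 2 ≤ A ^ 2 := pow_le_pow_left₀ hx.1 hx.2 2
  have h1 : y / (1 + x ^ 2) ≤ y := div_le_self hy (by nlinarith [sq_nonneg x])
  unfold pcond
  rw [one_div, neg_div]
  gcongr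

lemma pcond_le {A x y : ℝ} (hx : x ∈ Icc 0 A) (hy : 0 ≤ y) :
    pcond x y ≤ Real.exp (-((1 + A ^ 2)⁻¹ * y)) := by
  have hxA : x ^ 2 ≤ A ^ 2 := pow_le_pow_left₀ hx.1 hx.2 2
  have h1 : 1 / (1 + x ^ 2) ≤ 1 := by
    rw [div_le_one (by positivity)]; nlinarith [sq_nonneg x]
  have h2 : (1 + A ^ 2)⁻¹ * y ≤ y / (1 + x ^ 2) := by
    rw [div_eq_inv_mul]; gcongr
  unfold pcond
  calc _ ≤ 1 * Real.exp (-y / (1 + x ^ 2)) := by gcongr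
    _ ≤ _ := by rw [one_mul, neg_div]; gcongr

lemma IsDistOn.ae_mem {A : ℝ} {F : Measure ℝ} (hF : IsDistOn A F) : ∀ᵐ x ∂F, x ∈ Icc 0 A :=
  measure_eq_zero_iff_ae_notMem.mp hF.2 |>.mono fun x hx => by simpa using hx

lemma IsDistOn.integrable_of_continuousOn {A : ℝ} {F : Measure ℝ} (hF : IsDistOn A F) {f : ℝ → ℝ}
    (hf : ContinuousOn f (Icc 0 A)) : Integrable f F := by
  have := hF.1
  rw [← Measure.restrict_eq_self_of_ae_mem hF.ae_mem]
  exact hf.integrableOn_compact isCompact_Icc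

lemma integrable_pcond {A : ℝ} {F : Measure ℝ} (hF : IsDistOn A F) (y : ℝ) :
    Integrable (fun x => pcond x y) F :=
  hF.integrable_of_continuousOn (continuous_pcond_left y).continuousOn

lemma le_pout {A : ℝ} {F : Measure ℝ} (hF : IsDistOn A F) {y : ℝ} (hy : 0 ≤ y) :
    (1 + A ^ 2)⁻¹ * Real.exp (-y) ≤ pout F y := by
  have := hF.1
  have h := integral_mono_ae (integrable_const _) (integrable_pcond hF y)
    (hF.ae_mem.mono fun x hx => le_pcond hx hy)
  simpa [pout] using h

lemma pout_pos_of_nonneg {A : ℝ} {F : Measure ℝ} (hF : IsDistOn A F) {y : ℝ} (hy : 0 ≤ y) :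
    0 < pout F y :=
  lt_of_lt_of_le (by positivity) (le_pout hF hy)

lemma pout_le {A : ℝ} {F : Measure ℝ} (hF : IsDistOn A F) {y : ℝ} (hy : 0 ≤ y) :
    pout F y ≤ Real.exp (-((1 + A ^ 2)⁻¹ * y)) := by
  have := hF.1
  have h := integral_mono_ae (integrable_pcond hF y) (integrable_const _)
    (hF.ae_mem.mono fun x hx => pcond_le hx hy)
  simpa [pout] using h

lemma pout_le_one {A : ℝ} {F : Measure ℝ} (hF : IsDistOn A F) {y : ℝ} (hy : 0 ≤ y) :
    pout F y ≤ 1 :=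
  (pout_le hF hy).trans (by rw [Real.exp_le_one_iff]; simp; positivity)

lemma measurable_pout (F : Measure ℝ) [SFinite F] : Measurable (pout F) := by
  have h : StronglyMeasurable (Function.uncurry fun y x => pcond x y) :=
    (continuous_uncurry_pcond.comp continuous_swap).stronglyMeasurable
  exact h.integral_prod_right.measurable

lemma abs_log_pout_le {A : ℝ} {F : Measure ℝ} (hF : IsDistOn A F) {y : ℝ} (hy : 0 ≤ y) :
    |Real.log (pout F y)| ≤ Real.log (1 + A ^ 2) + y := by
  have h0 := pout_pos_of_nonneg hF hy
  have h1 := Real.log_nonpos h0.le (pout_le_one hF hy)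
  have h2 := Real.log_le_log (by positivity) (le_pout hF hy)
  rw [Real.log_mul (by positivity) (by positivity), Real.log_inv, Real.log_exp] at h2
  rw [abs_of_nonpos h1]; linarith

lemma integrableOn_exp_neg_mul {c : ℝ} (hc : 0 < c) :
    IntegrableOn (fun t : ℝ => Real.exp (-(c * t))) (Ioi 0) := by
  simpa [neg_mul] using integrableOn_exp_mul_Ioi (a := -c) (by linarith) 0

lemma integrableOn_exp_neg_mul_mul {c : ℝ} (hc : 0 < c) :
    IntegrableOn (fun t : ℝ => Real.exp (-(c * t)) * t) (Ioi 0) := by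
  have h := integrableOn_rpow_mul_exp_neg_mul_rpow (s := 1) (p := 1) (b := c)
    (by norm_num) one_pos hc
  refine h.congr_fun (fun t ht => ?_) measurableSet_Ioi
  simp [mul_comm]

lemma integrableOn_exp_neg_mul_sq :
    IntegrableOn (fun t : ℝ => Real.exp (-t) * t ^ 2) (Ioi 0) := by
  have h := integrableOn_rpow_mul_exp_neg_mul_rpow (s := 2) (p := 1) (b := 1)
    (by norm_num) one_pos one_pos
  refine h.congr_fun (fun t ht => ?_) measurableSet_Ioi
  simp [mul_comm]

lemma integral_exp_neg_mul_self : ∫ t in Ioi (0 : ℝ), Real.exp (-t) * t = 1 := by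
  have h := Real.Gamma_eq_integral (s := 2) (by norm_num)
  rw [Real.Gamma_two] at h
  rw [h]
  refine setIntegral_congr_fun measurableSet_Ioi fun t ht => ?_
  norm_num

lemma integral_exp_neg_mul_sq : ∫ t in Ioi (0 : ℝ), Real.exp (-t) * t ^ 2 = 2 := by
  have h := Real.Gamma_eq_integral (s := 3) (by norm_num)
  have h3 : Real.Gamma 3 = 2 := by
    norm_num
  rw [← h3, h]
  refine setIntegral_congr_fun measurableSet_Ioi fun t ht => ?_
  norm_num

lemma integrableOn_exp_neg_mul_log_pout {A : ℝ} {F : Measure ℝ} (hF : IsDistOn A F) {s : ℝ}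
    (hs : 0 < s) :
    IntegrableOn (fun t => Real.exp (-t) * Real.log (pout F (s * t))) (Ioi 0) := by
  have := hF.1
  have hbd : IntegrableOn (fun t : ℝ => Real.log (1 + A ^ 2) * Real.exp (-t) +
      s * (Real.exp (-t) * t)) (Ioi 0) := by
    have h1 := integrableOn_exp_neg_mul one_pos
    have h2 := integrableOn_exp_neg_mul_mul one_pos
    simp only [one_mul] at h1 h2
    exact (h1.const_mul _).add (h2.const_mul _)
  refine hbd.mono' ?_ ?_
  · have := measurable_pout F
    fun_prop
  · refine (ae_restrict_mem measurableSet_Ioi).mono fun t (ht : 0 < t) => ?_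
    rw [norm_mul, Real.norm_eq_abs, Real.norm_eq_abs, abs_of_pos (Real.exp_pos _)]
    have := mul_le_mul_of_nonneg_left (abs_log_pout_le hF (y := s * t) (by positivity))
      (Real.exp_pos (-t)).le
    linarith

/-- `idens F` as a function of the output mean `s = 1 + x ^ 2`. -/
noncomputable def meanIdens (F : Measure ℝ) (s : ℝ) : ℝ :=
  -Real.log s - 1 - ∫ t in Ioi (0 : ℝ), Real.exp (-t) * Real.log (pout F (s * t))

lemma idens_eq_meanIdens {A : ℝ} {F : Measure ℝ} (hF : IsDistOn A F) (x : ℝ) :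
    idens F x = meanIdens F (1 + x ^ 2) := by
  have hs : 0 < 1 + x ^ 2 := by positivity
  unfold idens meanIdens
  have h := integral_comp_mul_left_Ioi'
    (fun y => pcond x y * Real.log (pcond x y / pout F y)) 0 hs
  rw [mul_zero] at h
  rw [← h, smul_eq_mul, ← integral_const_mul]
  have h1 := integrableOn_exp_neg_mul one_pos
  have h2 := integrableOn_exp_neg_mul_mul one_pos
  simp only [one_mul] at h1 h2
  have h3 := integrableOn_exp_neg_mul_log_pout hF hs
  have key : ∀ t ∈ Ioi (0 : ℝ), (1 + x ^ 2) * (pcond x ((1 + x ^ 2) * t) *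
      Real.log (pcond x ((1 + x ^ 2) * t) / pout F ((1 + x ^ 2) * t))) =
      -Real.log (1 + x ^ 2) * Real.exp (-t) - Real.exp (-t) * t -
        Real.exp (-t) * Real.log (pout F ((1 + x ^ 2) * t)) := by
    intro t (ht : 0 < t)
    rw [Real.log_div (pcond_pos _ _).ne' (pout_pos_of_nonneg hF (by positivity)).ne']
    have hp : pcond x ((1 + x ^ 2) * t) = (1 + x ^ 2)⁻¹ * Real.exp (-t) := by
      unfold pcond
      rw [one_div]; congr 2; field_simp
    rw [hp, Real.log_mul (by positivity) (by positivity), Real.log_inv, Real.log_exp]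
    field_simp
    ring
  rw [setIntegral_congr_fun measurableSet_Ioi key, integral_sub, integral_sub,
    integral_const_mul, integral_exp_neg_Ioi_zero, integral_exp_neg_mul_self]
  · ring
  · exact h1.const_mul _
  · exact h2
  · exact (h1.const_mul _).sub h2
  · exact h3

lemma convexOn_sub_log_mgf {X : ℝ → ℝ} {ν : Measure ℝ} [IsFiniteMeasure ν] [NeZero ν]
    (hX : AEMeasurable X ν) {c : ℝ} (hc : ∀ᵐ x ∂ν, X x ∈ Icc 0 c) :
    ConvexOn ℝ univ fun u => c ^ 2 * u ^ 2 / 8 - ProbabilityTheory.cgf X ν u := by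
  have hintegrable : ∀ u, Integrable (fun x => Real.exp (u * X x)) ν := fun u => by
    refine ProbabilityTheory.integrable_exp_mul_of_mem_Icc hX hc
  have hset : interior (ProbabilityTheory.integrableExpSet X ν) = univ := by
    rw [interior_eq_univ]
    exact eq_univ_of_forall hintegrable
  have hmem : ∀ u, u ∈ interior (ProbabilityTheory.integrableExpSet X ν) := by simp [hset]
  have hcgf : ∀ u, AnalyticAt ℝ (ProbabilityTheory.cgf X ν) u := fun u =>
    ProbabilityTheory.analyticAt_cgf (hmem u)
  have hderiv : deriv (fun u => c ^ 2 * u ^ 2 / 8 - ProbabilityTheory.cgf X ν u) =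
      fun u => c ^ 2 * u / 4 - deriv (ProbabilityTheory.cgf X ν) u := by
    funext u
    have h1 : HasDerivAt (fun u : ℝ => c ^ 2 * u ^ 2 / 8) (c ^ 2 * (2 * u) / 8) u := by
      simpa using ((hasDerivAt_pow 2 u).const_mul (c ^ 2)).div_const 8
    refine (h1.sub (hcgf u).differentiableAt.hasDerivAt).deriv.trans ?_
    ring
  have hderiv2 : ∀ u, HasDerivAt (fun u => c ^ 2 * u / 4 - deriv (ProbabilityTheory.cgf X ν) u)
      (c ^ 2 / 4 - iteratedDeriv 2 (ProbabilityTheory.cgf X ν) u) u := by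
    intro u
    have h1 : HasDerivAt (fun u : ℝ => c ^ 2 * u / 4) (c ^ 2 / 4) u := by
      simpa using ((hasDerivAt_id u).const_mul (c ^ 2)).div_const 4
    rw [iteratedDeriv_succ, iteratedDeriv_one]
    exact h1.sub (hcgf u).deriv.differentiableAt.hasDerivAt
  refine convexOn_univ_of_deriv2_nonneg ?_ ?_ ?_
  · intro u
    have := (hcgf u).differentiableAt
    fun_prop
  · rw [hderiv]
    exact fun u => (hderiv2 u).differentiableAt
  · intro u
    rw [Function.iterate_succ, Function.iterate_one, Function.comp_apply, hderiv, (hderiv2 u).deriv,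
      ← ProbabilityTheory.variance_tilted_mul (hmem u)]
    have hac := tilted_absolutelyContinuous ν (u * X ·)
    have := isProbabilityMeasure_tilted (hintegrable u)
    have := ProbabilityTheory.variance_le_sq_of_bounded (μ := ν.tilted (u * X ·))
      (hac.ae_le hc) (hX.mono_ac hac)
    nlinarith

lemma convexOn_sub_log_pout {A a : ℝ} {F : Measure ℝ} (hF : IsDistOn A F) (ha : 0 < a)
    (hFa : ∀ᵐ x ∂F, a ≤ 1 + x ^ 2) :
    ConvexOn ℝ univ fun y => y ^ 2 / (8 * a ^ 2) - Real.log (pout F y) := by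
  have := hF.1
  set w : ℝ → ℝ := fun x => 1 / (1 + x ^ 2) with hw
  have hwc : Continuous w := by
    have h : ∀ x : ℝ, 1 + x ^ 2 ≠ 0 := fun x => by positivity
    rw [hw]; fun_prop (disch := simpa using h)
  have hw0 : ∀ x, 0 < w x := fun x => by simp only [hw]; positivity
  have hwi : Integrable w F := hF.integrable_of_continuousOn hwc.continuousOn
  set ν : Measure ℝ := F.withDensity fun x => ENNReal.ofReal (w x) with hν
  have hfin : IsFiniteMeasure ν := isFiniteMeasure_withDensity_ofReal hwi.2
  have hmgf : ∀ y, pout F y = ProbabilityTheory.mgf w ν (-y) := by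
    intro y
    unfold pout ProbabilityTheory.mgf
    rw [hν, integral_withDensity_eq_integral_toReal_smul (by fun_prop) (by simp)]
    refine integral_congr_ae (Eventually.of_forall fun x => ?_)
    simp only [ENNReal.toReal_ofReal (hw0 x).le, smul_eq_mul]
    simp only [hw, pcond]
    congr 2; ring
  have hne : NeZero ν := by
    refine ⟨fun h0 => ?_⟩
    have h := pout_pos_of_nonneg hF le_rfl
    rw [hmgf, h0] at h
    simp at h
  have hbd : ∀ᵐ x ∂ν, w x ∈ Icc 0 a⁻¹ := by
    refine (withDensity_absolutelyContinuous _ _).ae_le (hFa.mono fun x hx => ?_)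
    refine ⟨(hw0 x).le, ?_⟩
    simp only [hw, one_div]
    gcongr
  have h := convexOn_sub_log_mgf (ν := ν) hwc.aemeasurable hbd
  have h2 := h.comp_linearMap (-LinearMap.id)
  refine h2.congr fun y _ => ?_
  simp only [Function.comp, ProbabilityTheory.cgf, hmgf, LinearMap.neg_apply, LinearMap.id_apply]
  rw [neg_sq, inv_pow, inv_mul_eq_div, div_div, mul_comm (a ^ 2)]

lemma strictConvexOn_neg_log_sub_sq {a b : ℝ} (ha : 0 < a) (hab : b ^ 2 ≤ 2 * a ^ 2) :
    StrictConvexOn ℝ (Icc a b) fun s => -Real.log s - s ^ 2 / (4 * a ^ 2) := by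
  have hd : ∀ s : ℝ, 0 < s → HasDerivAt (fun s => -Real.log s - s ^ 2 / (4 * a ^ 2))
      (-s⁻¹ - s / (2 * a ^ 2)) s := by
    intro s hs
    have h1 : HasDerivAt (fun s : ℝ => s ^ 2 / (4 * a ^ 2)) (2 * s / (4 * a ^ 2)) s := by
      simpa using (hasDerivAt_pow 2 s).div_const (4 * a ^ 2)
    have h2 : 2 * s / (4 * a ^ 2) = s / (2 * a ^ 2) := by field_simp; norm_num
    rw [h2] at h1
    exact (Real.hasDerivAt_log hs.ne').neg.sub h1
  refine strictConvexOn_of_deriv2_pos (convex_Icc a b) ?_ ?_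
  · exact fun s hs => (hd s (ha.trans_le hs.1)).continuousAt.continuousWithinAt
  · intro s hs
    rw [interior_Icc] at hs
    have hs0 : 0 < s := ha.trans hs.1
    have hev : deriv (fun s => -Real.log s - s ^ 2 / (4 * a ^ 2)) =ᶠ[nhds s]
        fun s => -s⁻¹ - s / (2 * a ^ 2) :=
      (eventually_gt_nhds hs0).mono fun u hu => (hd u hu).deriv
    have h2 : HasDerivAt (fun s : ℝ => -s⁻¹ - s / (2 * a ^ 2))
        (-(-(s ^ 2)⁻¹) - 1 / (2 * a ^ 2)) s :=
      (hasDerivAt_inv hs0.ne').neg.sub ((hasDerivAt_id s).div_const _)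
    rw [Function.iterate_succ, Function.iterate_one, Function.comp_apply, hev.deriv_eq, h2.deriv,
      neg_neg, one_div, sub_pos]
    have : s ^ 2 < b ^ 2 := pow_lt_pow_left₀ hs.2 hs0.le two_ne_zero
    gcongr
    linarith

lemma strictConvexOn_meanIdens {A a b : ℝ} {F : Measure ℝ} (hF : IsDistOn A F) (ha : 0 < a)
    (hab : b ^ 2 ≤ 2 * a ^ 2) (hFa : ∀ᵐ x ∂F, a ≤ 1 + x ^ 2) :
    StrictConvexOn ℝ (Icc a b) (meanIdens F) := by
  have hconv := convexOn_sub_log_pout hF ha hFa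
  have hintegrable : ∀ s, 0 < s → IntegrableOn (fun t => Real.exp (-t) *
      ((s * t) ^ 2 / (8 * a ^ 2) - Real.log (pout F (s * t)))) (Ioi 0) ∧
      ∫ t in Ioi (0 : ℝ), Real.exp (-t) *
        ((s * t) ^ 2 / (8 * a ^ 2) - Real.log (pout F (s * t))) =
      s ^ 2 / (4 * a ^ 2) - ∫ t in Ioi (0 : ℝ), Real.exp (-t) * Real.log (pout F (s * t)) := by
    intro s hs
    have h1 := integrableOn_exp_neg_mul_sq.const_mul (s ^ 2 / (8 * a ^ 2))
    have h2 := integrableOn_exp_neg_mul_log_pout hF hs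
    have he : (fun t => Real.exp (-t) *
        ((s * t) ^ 2 / (8 * a ^ 2) - Real.log (pout F (s * t)))) =
        fun t => s ^ 2 / (8 * a ^ 2) * (Real.exp (-t) * t ^ 2) -
          Real.exp (-t) * Real.log (pout F (s * t)) := by
      funext t; ring
    rw [he]
    refine ⟨h1.sub h2, ?_⟩
    rw [integral_sub h1 h2, integral_const_mul, integral_exp_neg_mul_sq]
    ring
  have hrest : ConvexOn ℝ (Icc a b) fun s => ∫ t in Ioi (0 : ℝ), Real.exp (-t) *
      ((s * t) ^ 2 / (8 * a ^ 2) - Real.log (pout F (s * t))) := by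
    refine ⟨convex_Icc a b, fun s hs r hr α β hα hβ hαβ => ?_⟩
    have hs0 := ha.trans_le hs.1
    have hr0 := ha.trans_le hr.1
    have hm := convex_Icc a b hs hr hα hβ hαβ
    have hm0 : 0 < α • s + β • r := ha.trans_le hm.1
    simp only [smul_eq_mul] at hm0 ⊢
    rw [← integral_const_mul, ← integral_const_mul, ← integral_add
      ((hintegrable s hs0).1.const_mul α) ((hintegrable r hr0).1.const_mul β)]
    refine integral_mono (hintegrable _ hm0).1
      (((hintegrable s hs0).1.const_mul α).add ((hintegrable r hr0).1.const_mul β)) fun t => ?_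
    have h := hconv.2 (mem_univ (s * t)) (mem_univ (r * t)) hα hβ hαβ
    simp only [smul_eq_mul] at h
    have h' := mul_le_mul_of_nonneg_left h (Real.exp_pos (-t)).le
    have he : (α * s + β * r) * t = α * (s * t) + β * (r * t) := by ring
    dsimp only
    rw [he]
    linarith
  refine (((strictConvexOn_neg_log_sub_sq ha hab).add_convexOn hrest).add_const (-1)).congr
    fun s hs => ?_
  simp only [Pi.add_apply, (hintegrable s (ha.trans_le hs.1)).2, meanIdens]
  ring

lemma isDistOn_dirac {A x : ℝ} (hx : x ∈ Icc 0 A) : IsDistOn A (Measure.dirac x) :=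
  ⟨inferInstance, by simp [measurableSet_Icc.compl, hx]⟩

lemma pout_dirac (x y : ℝ) : pout (Measure.dirac x) y = pcond x y := by
  simp [pout]

lemma integrableOn_add_mul_exp_neg {c : ℝ} (hc : 0 < c) (L : ℝ) :
    IntegrableOn (fun y => Real.exp (-(c * y)) * (L + y)) (Ioi 0) := by
  simp only [mul_add]
  exact ((integrableOn_exp_neg_mul hc).mul_const L).add (integrableOn_exp_neg_mul_mul hc)

lemma ae_prod_mem {A : ℝ} {F : Measure ℝ} (hF : IsDistOn A F) :
    ∀ᵐ z ∂F.prod (volume.restrict (Ioi (0 : ℝ))), z.1 ∈ Icc 0 A ∧ 0 < z.2 := by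
  have := hF.1
  have h1 := Measure.quasiMeasurePreserving_fst (μ := F)
    (ν := volume.restrict (Ioi (0 : ℝ))) |>.ae hF.ae_mem
  have h2 := Measure.quasiMeasurePreserving_snd (μ := F)
    (ν := volume.restrict (Ioi (0 : ℝ))) |>.ae (ae_restrict_mem measurableSet_Ioi)
  filter_upwards [h1, h2] with z hz1 hz2 using ⟨hz1, hz2⟩

lemma integrable_prod_pcond_mul {A : ℝ} {F : Measure ℝ} (hF : IsDistOn A F) {f : ℝ × ℝ → ℝ}
    (hf : Measurable f)
    (hbd : ∀ z : ℝ × ℝ, z.1 ∈ Icc 0 A → 0 < z.2 → |f z| ≤ Real.log (1 + A ^ 2) + z.2) :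
    Integrable (fun z => pcond z.1 z.2 * f z) (F.prod (volume.restrict (Ioi (0 : ℝ)))) := by
  have := hF.1
  have hc : 0 < (1 + A ^ 2)⁻¹ := by positivity
  have hdom : Integrable (fun z : ℝ × ℝ => Real.exp (-((1 + A ^ 2)⁻¹ * z.2)) *
      (Real.log (1 + A ^ 2) + z.2)) (F.prod (volume.restrict (Ioi (0 : ℝ)))) :=
    (integrableOn_add_mul_exp_neg hc (Real.log (1 + A ^ 2))).integrable.comp_snd F
  refine hdom.mono' (continuous_uncurry_pcond.measurable.mul hf).aestronglyMeasurable ?_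
  filter_upwards [ae_prod_mem hF] with z ⟨hz1, hz2⟩
  rw [norm_mul, Real.norm_eq_abs, Real.norm_eq_abs, abs_of_pos (pcond_pos _ _)]
  exact mul_le_mul (pcond_le hz1 hz2.le) (hbd z hz1 hz2) (abs_nonneg _) (Real.exp_pos _).le

lemma integrable_prod_pcond_mul_log_pcond {A : ℝ} {F : Measure ℝ} (hF : IsDistOn A F) :
    Integrable (fun z : ℝ × ℝ => pcond z.1 z.2 * Real.log (pcond z.1 z.2))
      (F.prod (volume.restrict (Ioi (0 : ℝ)))) := by
  refine integrable_prod_pcond_mul hF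
    (Real.measurable_log.comp continuous_uncurry_pcond.measurable) fun z hz1 hz2 => ?_
  simpa only [pout_dirac] using abs_log_pout_le (isDistOn_dirac hz1) hz2.le

lemma integrable_prod_pcond_mul_log_pout {A : ℝ} {F G : Measure ℝ} (hF : IsDistOn A F)
    (hG : IsDistOn A G) :
    Integrable (fun z : ℝ × ℝ => pcond z.1 z.2 * Real.log (pout G z.2))
      (F.prod (volume.restrict (Ioi (0 : ℝ)))) := by
  have := hG.1
  exact integrable_prod_pcond_mul hF
    (Real.measurable_log.comp ((measurable_pout G).comp measurable_snd))
    fun z _ hz2 => abs_log_pout_le hG hz2.le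

lemma integrable_prod_pcond {A : ℝ} {F : Measure ℝ} (hF : IsDistOn A F) :
    Integrable (fun z : ℝ × ℝ => pcond z.1 z.2) (F.prod (volume.restrict (Ioi (0 : ℝ)))) := by
  have := hF.1
  have hdom : Integrable (fun z : ℝ × ℝ => Real.exp (-((1 + A ^ 2)⁻¹ * z.2)))
      (F.prod (volume.restrict (Ioi (0 : ℝ)))) :=
    (integrableOn_exp_neg_mul (c := (1 + A ^ 2)⁻¹) (by positivity)).integrable.comp_snd F
  refine hdom.mono' continuous_uncurry_pcond.measurable.aestronglyMeasurable ?_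
  filter_upwards [ae_prod_mem hF] with z ⟨hz1, hz2⟩
  rw [Real.norm_eq_abs, abs_of_pos (pcond_pos _ _)]
  exact pcond_le hz1 hz2.le

lemma idens_eq_integral_sub {A : ℝ} {G : Measure ℝ} (hG : IsDistOn A G) (x : ℝ) :
    idens G x = ∫ y in Ioi (0 : ℝ),
      (pcond x y * Real.log (pcond x y) - pcond x y * Real.log (pout G y)) := by
  refine setIntegral_congr_fun measurableSet_Ioi fun y (hy : 0 < y) => ?_
  rw [Real.log_div (pcond_pos x y).ne' (pout_pos_of_nonneg hG hy.le).ne']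
  ring

lemma integrable_idens {A : ℝ} {F G : Measure ℝ} (hF : IsDistOn A F) (hG : IsDistOn A G) :
    Integrable (idens G) F := by
  have := hF.1
  have h := ((integrable_prod_pcond_mul_log_pcond hF).sub
    (integrable_prod_pcond_mul_log_pout hF hG)).integral_prod_left
  exact h.congr (Eventually.of_forall fun x => (idens_eq_integral_sub hG x).symm)

lemma integral_idens {A : ℝ} {F G : Measure ℝ} (hF : IsDistOn A F) (hG : IsDistOn A G) :
    ∫ x, idens G x ∂F =
      ∫ z : ℝ × ℝ, pcond z.1 z.2 * Real.log (pcond z.1 z.2)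
        ∂F.prod (volume.restrict (Ioi (0 : ℝ))) -
      ∫ y in Ioi (0 : ℝ), pout F y * Real.log (pout G y) := by
  have := hF.1
  have h1 := integrable_prod_pcond_mul_log_pcond hF
  have h2 := integrable_prod_pcond_mul_log_pout hF hG
  have h3 : ∫ z : ℝ × ℝ, pcond z.1 z.2 * Real.log (pout G z.2)
      ∂F.prod (volume.restrict (Ioi (0 : ℝ))) =
      ∫ y in Ioi (0 : ℝ), pout F y * Real.log (pout G y) := by
    rw [integral_prod_symm _ h2]
    simp only [integral_mul_const, pout]
  rw [← h3, ← integral_sub h1 h2]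
  exact (integral_congr_ae (Eventually.of_forall fun x => idens_eq_integral_sub hG x)).trans
    (integral_prod _ (h1.sub h2)).symm

lemma integral_pcond (x : ℝ) : ∫ y in Ioi (0 : ℝ), pcond x y = 1 := by
  have hs : 0 < 1 + x ^ 2 := by positivity
  have h := integral_comp_mul_left_Ioi' (fun y => pcond x y) 0 hs
  rw [mul_zero] at h
  rw [← h, smul_eq_mul, ← integral_const_mul]
  refine (setIntegral_congr_fun measurableSet_Ioi fun t _ => ?_).trans integral_exp_neg_Ioi_zero
  have he : -((1 + x ^ 2) * t) / (1 + x ^ 2) = -t := by field_simp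
  simp only [pcond, he]
  field_simp

lemma integrableOn_pout {A : ℝ} {F : Measure ℝ} (hF : IsDistOn A F) :
    IntegrableOn (pout F) (Ioi 0) := by
  have := hF.1
  exact (integrable_prod_pcond hF).integral_prod_right

lemma integral_pout {A : ℝ} {F : Measure ℝ} (hF : IsDistOn A F) :
    ∫ y in Ioi (0 : ℝ), pout F y = 1 := by
  have := hF.1
  have h := integrable_prod_pcond hF
  have h1 := integral_prod_symm _ h
  rw [integral_prod _ h] at h1
  simp only [integral_pcond] at h1
  simpa [pout] using h1.symm

lemma integrableOn_pout_mul_log_pout {A : ℝ} {F G : Measure ℝ} (hF : IsDistOn A F)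
    (hG : IsDistOn A G) :
    IntegrableOn (fun y => pout F y * Real.log (pout G y)) (Ioi 0) := by
  have := hF.1
  have h := (integrable_prod_pcond_mul_log_pout hF hG).integral_prod_right
  simp only [integral_mul_const] at h
  exact h

/-- Replacing the reference output law by that of another input can only increase the average
divergence. -/
lemma MI_le_integral_idens {A : ℝ} {F G : Measure ℝ} (hF : IsDistOn A F) (hG : IsDistOn A G) :
    MI F ≤ ∫ x, idens G x ∂F := by
  have hFF := integrableOn_pout_mul_log_pout hF hF
  have hFG := integrableOn_pout_mul_log_pout hF hG
  have key : ∫ y in Ioi (0 : ℝ), (pout F y - pout G y) ≤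
      ∫ y in Ioi (0 : ℝ), (pout F y * Real.log (pout F y) - pout F y * Real.log (pout G y)) := by
    refine setIntegral_mono_on ((integrableOn_pout hF).sub (integrableOn_pout hG)) (hFF.sub hFG)
      measurableSet_Ioi fun y (hy : 0 < y) => ?_
    have hp := pout_pos_of_nonneg hF hy.le
    have hq := pout_pos_of_nonneg hG hy.le
    have h := Real.log_le_sub_one_of_pos (div_pos hq hp)
    rw [Real.log_div hq.ne' hp.ne'] at h
    have h' := mul_le_mul_of_nonneg_left h hp.le
    have he : pout F y * (pout G y / pout F y - 1) = pout G y - pout F y := by field_simp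
    rw [he] at h'
    linarith
  rw [integral_sub (integrableOn_pout hF) (integrableOn_pout hG), integral_pout hF,
    integral_pout hG, integral_sub hFF hFG] at key
  rw [MI, integral_idens hF hF, integral_idens hF hG]
  linarith

lemma summable_pow_div_factorial_sq {v : ℝ} (hv : 0 ≤ v) :
    Summable fun n : ℕ => v ^ n / (n.factorial : ℝ) ^ 2 := by
  refine (Real.summable_pow_div_factorial v).of_nonneg_of_le (fun n => by positivity) fun n => ?_
  have h : (1 : ℝ) ≤ n.factorial := by exact_mod_cast n.factorial_pos
  gcongr
  nlinarith

lemma convexOn_tsum_pow_div_factorial_sq :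
    ConvexOn ℝ (Ici 0) fun v : ℝ => ∑' n : ℕ, v ^ n / (n.factorial : ℝ) ^ 2 := by
  refine ⟨convex_Ici 0, fun u hu v hv α β hα hβ hαβ => ?_⟩
  have hm : 0 ≤ α • u + β • v := convex_Ici (0 : ℝ) hu hv hα hβ hαβ
  have hsu := (summable_pow_div_factorial_sq hu).mul_left α
  have hsv := (summable_pow_div_factorial_sq hv).mul_left β
  simp only [smul_eq_mul] at hm ⊢
  rw [← tsum_mul_left, ← tsum_mul_left, ← hsu.tsum_add hsv]
  refine (summable_pow_div_factorial_sq hm).tsum_le_tsum (fun n => ?_) (hsu.add hsv)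
  have h := (convexOn_pow n).2 hu hv hα hβ hαβ
  simp only [smul_eq_mul] at h
  rw [← mul_div_assoc, ← mul_div_assoc, ← add_div]
  gcongr

lemma monotoneOn_tsum_pow_div_factorial_sq :
    MonotoneOn (fun v : ℝ => ∑' n : ℕ, v ^ n / (n.factorial : ℝ) ^ 2) (Ici 0) := by
  intro u hu v hv huv
  refine (summable_pow_div_factorial_sq hu).tsum_le_tsum (fun n => ?_)
    (summable_pow_div_factorial_sq hv)
  have : (0 : ℝ) ≤ u := hu
  gcongr

lemma continuousOn_tsum_pow_div_factorial_sq (T : ℝ) :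
    ContinuousOn (fun v : ℝ => ∑' n : ℕ, v ^ n / (n.factorial : ℝ) ^ 2) (Icc 0 T) := by
  rcases lt_or_ge T 0 with hT | hT
  · simp [Icc_eq_empty_of_lt hT]
  refine continuousOn_tsum (fun n => by fun_prop) (summable_pow_div_factorial_sq hT)
    fun n v hv => ?_
  rw [Real.norm_of_nonneg (by have := hv.1; positivity)]
  have := hv.1
  gcongr
  exact hv.2

lemma EH_eq_tsum (B h2 x : ℝ) :
    EH B h2 x = ∑' n : ℕ, ((Real.sqrt 2 * B * h2) ^ 2 / 4 * x ^ 2) ^ n /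
      (n.factorial : ℝ) ^ 2 := by
  unfold EH besselI0
  congr 1
  funext n
  congr 2
  ring

lemma continuousOn_EH (B h2 A : ℝ) : ContinuousOn (EH B h2) (Icc 0 A) := by
  have h := (continuousOn_tsum_pow_div_factorial_sq
    ((Real.sqrt 2 * B * h2) ^ 2 / 4 * A ^ 2)).comp
    (f := fun x : ℝ => (Real.sqrt 2 * B * h2) ^ 2 / 4 * x ^ 2) (s := Icc 0 A)
    (by fun_prop) fun x hx => ⟨by positivity,
      mul_le_mul_of_nonneg_left (pow_le_pow_left₀ hx.1 hx.2 2) (by positivity)⟩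
  exact h.congr fun x _ => EH_eq_tsum B h2 x

lemma EH_le_EH (B h2 : ℝ) {x y : ℝ} (hx : 0 ≤ x) (hxy : x ≤ y) : EH B h2 x ≤ EH B h2 y := by
  rw [EH_eq_tsum, EH_eq_tsum]
  refine monotoneOn_tsum_pow_div_factorial_sq (mem_Ici.2 (by positivity))
    (mem_Ici.2 (by positivity)) ?_
  gcongr

/-- The weight with which mass at `x` is moved to `a` when it is split between `a` and `b` so
that the mean of `x ^ 2` is preserved. -/
noncomputable def splitWeight (a b x : ℝ) : ℝ := (b ^ 2 - x ^ 2) / (b ^ 2 - a ^ 2)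

lemma splitWeight_mem {a b x : ℝ} (ha : 0 ≤ a) (hx : x ∈ Ioo a b) :
    splitWeight a b x ∈ Ioo 0 1 := by
  have h1 : a ^ 2 < x ^ 2 := pow_lt_pow_left₀ hx.1 ha two_ne_zero
  have h2 : x ^ 2 < b ^ 2 := pow_lt_pow_left₀ hx.2 (ha.trans hx.1.le) two_ne_zero
  unfold splitWeight
  refine ⟨div_pos (by linarith) (by linarith), ?_⟩
  rw [div_lt_one (by linarith)]
  linarith

lemma splitWeight_combination {a b x : ℝ} (ha : 0 ≤ a) (hx : x ∈ Ioo a b) :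
    splitWeight a b x * a ^ 2 + (1 - splitWeight a b x) * b ^ 2 = x ^ 2 := by
  have h1 : a ^ 2 < b ^ 2 := pow_lt_pow_left₀ (hx.1.trans hx.2) ha two_ne_zero
  have h : b ^ 2 - a ^ 2 ≠ 0 := by linarith
  unfold splitWeight
  field_simp
  ring

/-- Sweep the mass of `F` on `(a, b)` to the endpoints, preserving the mean of `x ^ 2`. -/
noncomputable def sweep (a b : ℝ) (F : Measure ℝ) : Measure ℝ :=
  F.restrict (Ioo a b)ᶜ +
    (ENNReal.ofReal (∫ x in Ioo a b, splitWeight a b x ∂F) • Measure.dirac a +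
      ENNReal.ofReal (∫ x in Ioo a b, (1 - splitWeight a b x) ∂F) • Measure.dirac b)

lemma integrable_splitWeight {A : ℝ} {F : Measure ℝ} (hF : IsDistOn A F) (a b : ℝ) :
    Integrable (splitWeight a b) F :=
  hF.integrable_of_continuousOn (by unfold splitWeight; fun_prop)

lemma integrable_sweep {F : Measure ℝ} {g : ℝ → ℝ} (hg : Integrable g F) (a b : ℝ) :
    Integrable g (sweep a b F) := by
  refine (hg.mono_measure Measure.restrict_le_self).add_measure (Integrable.add_measure ?_ ?_)
  · exact (integrable_dirac (by simp)).smul_measure ENNReal.ofReal_ne_top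
  · exact (integrable_dirac (by simp)).smul_measure ENNReal.ofReal_ne_top

lemma integral_sweep {A a b : ℝ} {F : Measure ℝ} (hF : IsDistOn A F) (ha : 0 ≤ a) {g : ℝ → ℝ}
    (hg : Integrable g F) :
    IntegrableOn (fun x => splitWeight a b x * g a + (1 - splitWeight a b x) * g b - g x)
      (Ioo a b) F ∧
    ∫ x, g x ∂sweep a b F = ∫ x, g x ∂F +
      ∫ x in Ioo a b, (splitWeight a b x * g a + (1 - splitWeight a b x) * g b - g x) ∂F := by
  have := hF.1
  have hw : IntegrableOn (splitWeight a b) (Ioo a b) F :=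
    (integrable_splitWeight hF a b).integrableOn
  have hw' : IntegrableOn (fun x => 1 - splitWeight a b x) (Ioo a b) F :=
    (integrable_const 1).sub hw
  have h1 := hw.mul_const (g a)
  have h2 := hw'.mul_const (g b)
  have h0 : 0 ≤ ∫ x in Ioo a b, splitWeight a b x ∂F :=
    setIntegral_nonneg measurableSet_Ioo fun x hx => (splitWeight_mem ha hx).1.le
  have h0' : 0 ≤ ∫ x in Ioo a b, (1 - splitWeight a b x) ∂F :=
    setIntegral_nonneg measurableSet_Ioo fun x hx => by linarith [(splitWeight_mem ha hx).2]
  refine ⟨(h1.add h2).sub hg.integrableOn, ?_⟩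
  have hd : ∀ (c : ℝ) (r : ℝ), Integrable g (ENNReal.ofReal r • Measure.dirac c) := fun c r =>
    (integrable_dirac (by simp)).smul_measure ENNReal.ofReal_ne_top
  have hsplit : ∫ x in Ioo a b,
      (splitWeight a b x * g a + (1 - splitWeight a b x) * g b - g x) ∂F =
      ∫ x in Ioo a b, splitWeight a b x * g a ∂F +
        ∫ x in Ioo a b, (1 - splitWeight a b x) * g b ∂F - ∫ x in Ioo a b, g x ∂F := by
    rw [← integral_add h1 h2]
    exact integral_sub (h1.add h2) hg.integrableOn
  unfold sweep
  rw [integral_add_measure (hg.mono_measure Measure.restrict_le_self)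
      ((hd _ _).add_measure (hd _ _)), integral_add_measure (hd _ _) (hd _ _),
    integral_smul_measure, integral_smul_measure, integral_dirac, integral_dirac,
    ENNReal.toReal_ofReal h0, ENNReal.toReal_ofReal h0',
    hsplit, integral_mul_const, integral_mul_const, ← integral_add_compl measurableSet_Ioo hg,
    smul_eq_mul, smul_eq_mul]
  ring

lemma ae_sweep {a b : ℝ} {F : Measure ℝ} {p : ℝ → Prop} (hp : ∀ᵐ x ∂F, p x) (ha : p a)
    (hb : p b) : ∀ᵐ x ∂sweep a b F, p x := by
  unfold sweep
  rw [ae_add_measure_iff, ae_add_measure_iff]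
  refine ⟨ae_restrict_of_ae hp, Measure.ae_smul_measure ?_ _, Measure.ae_smul_measure ?_ _⟩
  · rw [ae_dirac_eq]; exact ha
  · rw [ae_dirac_eq]; exact hb

lemma isDistOn_sweep {A a b : ℝ} {F : Measure ℝ} (hF : IsDistOn A F) (ha : 0 ≤ a) (hab : a ≤ b)
    (hb : b ≤ A) : IsDistOn A (sweep a b F) := by
  have := hF.1
  constructor
  · have h := (integral_sweep (b := b) hF ha (integrable_const (1 : ℝ))).2
    have : IsFiniteMeasure (sweep a b F) := by
      have h1 := integrable_sweep (integrable_const (1 : ℝ)) a b (F := F)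
      rw [integrable_const_iff] at h1
      simpa using h1
    rw [integral_const, integral_const] at h
    refine ⟨?_⟩
    rw [← ENNReal.toReal_eq_one_iff]
    simpa [Measure.real] using h
  · exact measure_eq_zero_iff_ae_notMem.mpr <|
      (ae_sweep hF.ae_mem ⟨ha, hab.trans hb⟩ ⟨ha.trans hab, hb⟩).mono fun x hx => by simpa using hx

lemma exists_feas_MI_lt {A P B h2 Ereq a b : ℝ} {F : Measure ℝ} (hF : Feas A P B h2 Ereq F)
    (ha : 0 ≤ a) (hab : a < b) (hb : b ≤ A) (hratio : (1 + b ^ 2) ^ 2 ≤ 2 * (1 + a ^ 2) ^ 2)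
    (hFa : ∀ᵐ x ∂F, a ≤ x) (hpos : 0 < F (Ioo a b)) :
    ∃ G, Feas A P B h2 Ereq G ∧ MI F < MI G := by
  obtain ⟨hdist, hpow, hEH⟩ := hF
  have := hdist.1
  have hG := isDistOn_sweep hdist ha hab.le hb
  refine ⟨sweep a b F, ⟨hG, ?_, ?_⟩, ?_⟩
  · have hsq : Integrable (fun x : ℝ => x ^ 2) F :=
      hdist.integrable_of_continuousOn (by fun_prop)
    rw [(integral_sweep hdist ha hsq).2, setIntegral_eq_zero_of_forall_eq_zero, add_zero]
    · exact hpow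
    · intro x hx
      rw [splitWeight_combination ha hx, sub_self]
  · have h := integral_sweep (b := b) hdist ha
      (hdist.integrable_of_continuousOn (continuousOn_EH B h2 A))
    rw [h.2]
    refine hEH.trans (le_add_of_nonneg_right (setIntegral_nonneg measurableSet_Ioo fun x hx => ?_))
    have hw := splitWeight_mem ha hx
    have hc := convexOn_tsum_pow_div_factorial_sq.2
      (mem_Ici.2 (by positivity : 0 ≤ (Real.sqrt 2 * B * h2) ^ 2 / 4 * a ^ 2))
      (mem_Ici.2 (by positivity : 0 ≤ (Real.sqrt 2 * B * h2) ^ 2 / 4 * b ^ 2))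
      hw.1.le (sub_nonneg.2 hw.2.le) (by ring)
    have he : splitWeight a b x * ((Real.sqrt 2 * B * h2) ^ 2 / 4 * a ^ 2) +
        (1 - splitWeight a b x) * ((Real.sqrt 2 * B * h2) ^ 2 / 4 * b ^ 2) =
        (Real.sqrt 2 * B * h2) ^ 2 / 4 * x ^ 2 := by
      rw [← splitWeight_combination ha hx]; ring
    simp only [smul_eq_mul] at hc
    rw [he, ← EH_eq_tsum, ← EH_eq_tsum, ← EH_eq_tsum] at hc
    linarith
  · refine (MI_le_integral_idens hdist hG).trans_lt ?_
    have h := integral_sweep (b := b) hdist ha (integrable_idens hdist hG)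
    have hGa : ∀ᵐ x ∂sweep a b F, 1 + a ^ 2 ≤ 1 + x ^ 2 :=
      (ae_sweep hFa le_rfl hab.le).mono fun x hx => by gcongr
    have hstrict := strictConvexOn_meanIdens hG (by positivity) hratio hGa
    have hpt : ∀ x ∈ Ioo a b, 0 < splitWeight a b x * idens (sweep a b F) a +
        (1 - splitWeight a b x) * idens (sweep a b F) b - idens (sweep a b F) x := by
      intro x hx
      have hw := splitWeight_mem ha hx
      have hlt : a ^ 2 < b ^ 2 := pow_lt_pow_left₀ hab ha two_ne_zero
      have hc := hstrict.2 (left_mem_Icc.2 (by linarith)) (right_mem_Icc.2 (by linarith))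
        (by linarith : 1 + a ^ 2 < 1 + b ^ 2).ne hw.1 (sub_pos.2 hw.2) (by ring)
      have he : splitWeight a b x * (1 + a ^ 2) + (1 - splitWeight a b x) * (1 + b ^ 2) =
          1 + x ^ 2 := by
        rw [← splitWeight_combination ha hx]; ring
      simp only [smul_eq_mul] at hc
      rw [he, ← idens_eq_meanIdens hG, ← idens_eq_meanIdens hG, ← idens_eq_meanIdens hG] at hc
      linarith
    have hgt : 0 < ∫ x in Ioo a b, (splitWeight a b x * idens (sweep a b F) a +
        (1 - splitWeight a b x) * idens (sweep a b F) b - idens (sweep a b F) x) ∂F := by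
      rw [setIntegral_pos_iff_support_of_nonneg_ae
        ((ae_restrict_mem measurableSet_Ioo).mono fun x hx => (hpt x hx).le) h.1]
      refine hpos.trans_le (measure_mono fun x hx => ⟨(hpt x hx).ne', hx⟩)
    rw [MI, h.2]
    linarith

lemma MI_eq_zero_of_ae_eq {F : Measure ℝ} [IsProbabilityMeasure F] {c : ℝ}
    (hF : ∀ᵐ x ∂F, x = c) : MI F = 0 := by
  have hp : ∀ y, pout F y = pcond c y := fun y => by
    unfold pout
    rw [integral_congr_ae (g := fun _ => pcond c y) (hF.mono fun x hx => by simp only [hx])]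
    simp
  have hi : idens F c = 0 := by
    unfold idens
    simp [hp, div_self (pcond_pos _ _).ne']
  unfold MI
  rw [integral_congr_ae (g := fun _ => 0) (hF.mono fun x hx => by simp only [hx, hi])]
  simp

lemma exists_radius (c : ℝ) :
    ∃ ε > 0, ∀ δ ∈ Ioo 0 ε, (1 + (c + δ) ^ 2) ^ 2 ≤ 2 * (1 + (c - δ) ^ 2) ^ 2 := by
  have hcont : Continuous fun δ : ℝ => 2 * (1 + (c - δ) ^ 2) ^ 2 - (1 + (c + δ) ^ 2) ^ 2 := by
    fun_prop
  have hev := (hcont.tendsto 0).eventually_const_lt (u := 0)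
    (by nlinarith [sq_nonneg c, sq_nonneg (c ^ 2)])
  obtain ⟨ε, hε, h⟩ := Metric.eventually_nhds_iff.1 hev
  refine ⟨ε, hε, fun δ hδ => ?_⟩
  have := h (y := δ) (by simpa [abs_of_pos hδ.1] using hδ.2)
  linarith

lemma exists_feas_MI_lt_of_essInf {A P B h2 Ereq c : ℝ} {F : Measure ℝ}
    (hF : Feas A P B h2 Ereq F) (hc : 0 < c) (hcA : c < A) (hbelow : ∀ t < c, F (Iio t) = 0)
    (habove : ∀ t > c, F (Iio t) ≠ 0) : ∃ G, Feas A P B h2 Ereq G ∧ MI F < MI G := by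
  obtain ⟨ε, hε, h⟩ := exists_radius c
  obtain ⟨δ, hδ0, hδ⟩ := exists_between (lt_min hε (lt_min hc (sub_pos.2 hcA)))
  simp only [lt_min_iff] at hδ
  refine exists_feas_MI_lt hF (a := c - δ) (b := c + δ) (by linarith) (by linarith) (by linarith)
    (h δ ⟨hδ0, hδ.1⟩) ?_ ?_
  · have h0 := measure_eq_zero_iff_ae_notMem.1 (hbelow (c - δ) (by linarith))
    exact h0.mono fun x hx => not_lt.1 hx
  · refine pos_iff_ne_zero.2 fun h0 => habove (c + δ) (by linarith) ?_
    refine measure_mono_null (t := Iio (c - δ / 2) ∪ Ioo (c - δ) (c + δ)) (fun x hx => ?_)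
      (measure_union_null (hbelow _ (by linarith)) h0)
    rcases lt_or_ge x (c - δ / 2) with h1 | h1
    · exact Or.inl h1
    · exact Or.inr ⟨by linarith, hx⟩

/-- If `Ω` is nonempty and a Slater point exists, then the
capacity-achieving input distribution `F*` (a maximizer of `I` over `Ω`) has a mass
point at zero: `0` belongs to the topological support of `F*`. -/
theorem stmt18 (A P B h2 Ereq : ℝ) (hA : 0 < A) (hP : 0 < P) (hB : 0 < B) (hh2 : 0 < h2)
    (hne : ∃ F : Measure ℝ, Feas A P B h2 Ereq F)
    (hslater : ∃ x₁ ∈ Set.Icc (0 : ℝ) A, x₁ ^ 2 < P ∧ Ereq < EH B h2 x₁)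
    (Fstar : Measure ℝ) (hFstar : Feas A P B h2 Ereq Fstar)
    (hmax : ∀ F : Measure ℝ, Feas A P B h2 Ereq F → MI F ≤ MI Fstar) :
    (0 : ℝ) ∈ msupp Fstar := by

  have hdist := hFstar.1
  have := hdist.1
  have hopt : ¬ ∃ G, Feas A P B h2 Ereq G ∧ MI Fstar < MI G := fun ⟨G, hG, hlt⟩ =>
    (hmax G hG).not_gt hlt
  by_contra hsupp
  simp only [msupp, mem_ofPred_eq, not_forall, not_lt, nonpos_iff_eq_zero] at hsupp
  obtain ⟨U, hUo, hU0, hFU⟩ := hsupp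
  obtain ⟨r, hr, hball⟩ := Metric.isOpen_iff.1 hUo 0 hU0
  have hrS : Fstar (Iio r) = 0 := by
    refine measure_mono_null (t := U ∪ (Icc 0 A)ᶜ) (fun x hx => ?_)
      (measure_union_null hFU hdist.2)
    by_cases hx0 : 0 ≤ x
    · exact Or.inl (hball (by simpa [abs_of_nonneg hx0] using hx))
    · exact Or.inr fun h => hx0 h.1
  set S : Set ℝ := {t | Fstar (Iio t) = 0} with hS
  have hSA : ∀ t ∈ S, t ≤ A := by
    intro t ht
    by_contra! hlt
    have h : ∀ᵐ x ∂Fstar, False := by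
      filter_upwards [hdist.ae_mem, measure_eq_zero_iff_ae_notMem.1 ht] with x hx hx'
      exact hx' (hx.2.trans_lt hlt)
    simp at h
    exact IsProbabilityMeasure.ne_zero Fstar h
  have hbdd : BddAbove S := ⟨A, hSA⟩
  have hbelow : ∀ t < sSup S, Fstar (Iio t) = 0 := by
    intro t ht
    obtain ⟨u, hu, htu⟩ := exists_lt_of_lt_csSup ⟨r, hrS⟩ ht
    exact measure_mono_null (Iio_subset_Iio htu.le) hu
  have habove : ∀ t > sSup S, Fstar (Iio t) ≠ 0 := fun t ht h => (le_csSup hbdd h).not_gt ht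
  have hc0 : 0 < sSup S := hr.trans_le (le_csSup hbdd hrS)
  rcases (csSup_le ⟨r, hrS⟩ hSA).lt_or_eq with hcA | hcA
  · exact hopt (exists_feas_MI_lt_of_essInf hFstar hc0 hcA hbelow habove)
  · rw [hcA] at hbelow
    have hae : ∀ᵐ x ∂Fstar, x = A := by
      have h : ∀ᵐ x ∂Fstar, ∀ n : ℕ, A - 1 / ((n : ℝ) + 1) ≤ x := by
        refine ae_all_iff.2 fun n => ?_
        have h0 := measure_eq_zero_iff_ae_notMem.1
          (hbelow (A - 1 / ((n : ℝ) + 1)) (sub_lt_self A Nat.one_div_pos_of_nat))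
        exact h0.mono fun x hx => not_lt.1 hx
      filter_upwards [h, hdist.ae_mem] with x hx hxA
      refine le_antisymm hxA.2 (le_of_forall_pos_lt_add fun ε hε => ?_)
      obtain ⟨n, hn⟩ := exists_nat_one_div_lt hε
      linarith [hx n]
    obtain ⟨x₁, hx₁, -, hx₁E⟩ := hslater
    have hEA : Ereq < EH B h2 A := hx₁E.trans_le (EH_le_EH B h2 hx₁.1 hx₁.2)
    have hAP : A ^ 2 ≤ P := by
      have h := hFstar.2.1
      rw [integral_congr_ae (g := fun _ => A ^ 2) (hae.mono fun x hx => by simp only [hx])] at h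
      simpa only [integral_const, probReal_univ, one_smul] using h
    obtain ⟨c, hc, hcE⟩ : ∃ c ∈ Ioo 0 A, Ereq < EH B h2 c := by
      have hcont := (continuousOn_EH B h2 A A (right_mem_Icc.2 hA.le)).mono Ioo_subset_Icc_self
      have := right_nhdsWithin_Ioo_neBot hA
      obtain ⟨c, hcE, hc⟩ :=
        ((hcont.eventually_const_lt hEA).and eventually_mem_nhdsWithin).exists
      exact ⟨c, hc, hcE⟩
    have hfeas : Feas A P B h2 Ereq (Measure.dirac c) := by
      refine ⟨isDistOn_dirac ⟨hc.1.le, hc.2.le⟩, ?_, ?_⟩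
      · rw [integral_dirac]
        exact (pow_le_pow_left₀ hc.1.le hc.2.le 2).trans hAP
      · rw [integral_dirac]
        exact hcE.le
    have hMI : MI Fstar = MI (Measure.dirac c) := by
      rw [MI_eq_zero_of_ae_eq hae, MI_eq_zero_of_ae_eq (c := c) (by simp [ae_dirac_eq])]
    refine hopt (hMI ▸ exists_feas_MI_lt_of_essInf hfeas hc.1 hc.2 (fun t ht => ?_) fun t ht => ?_)
    · simpa [measurableSet_Iio] using ht.le
    · simpa [measurableSet_Iio] using ht
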